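/- arXiv:hep-th/9303148 — 2 statements merged into one kernel-verified Lean document; each statement's English description precedes it below -/
import Mathlib

section
/- For the standard GL_q(2) R-matrix, the element γ = q⁻²a + d satisfies [γ, x] = (q⁶+1)q⁻⁴ x for x ∈ {ξ, b, c} where ξ = d − a, under the braided-Lie bracket determined by c^{IJ}_K. -/
open Matrix

variable {k : Type*} [Field k] {n : ℕ}

/-- Pairs of indices, labelling a basis of `V ⊗ V` (or multi-indices `I = (i₀, i₁)`). -/
abbrev I2 (n : ℕ) := Fin n × Fin n

/-- Triples of indices, labelling a basis of `V ⊗ V ⊗ V`. -/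
abbrev I3 (n : ℕ) := Fin n × Fin n × Fin n

/-- `A₁₂ = A ⊗ id`, the lift of an operator on `V ⊗ V` to the first two factors of
`V ⊗ V ⊗ V`. -/
def amp12 (A : Matrix (I2 n) (I2 n) k) : Matrix (I3 n) (I3 n) k :=
  Matrix.of fun p q => A (p.1, p.2.1) (q.1, q.2.1) * (if p.2.2 = q.2.2 then 1 else 0)

/-- `A₁₃`, acting on the first and third factors of `V ⊗ V ⊗ V`. -/
def amp13 (A : Matrix (I2 n) (I2 n) k) : Matrix (I3 n) (I3 n) k :=
  Matrix.of fun p q => A (p.1, p.2.2) (q.1, q.2.2) * (if p.2.1 = q.2.1 then 1 else 0)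

/-- `A₂₃`, acting on the last two factors of `V ⊗ V ⊗ V`. -/
def amp23 (A : Matrix (I2 n) (I2 n) k) : Matrix (I3 n) (I3 n) k :=
  Matrix.of fun p q => A (p.2.1, p.2.2) (q.2.1, q.2.2) * (if p.1 = q.1 then 1 else 0)

/-- `A₂₁ = τ ∘ A ∘ τ`, conjugation by the flip of the two tensor factors. -/
def flipM (A : Matrix (I2 n) (I2 n) k) : Matrix (I2 n) (I2 n) k :=
  Matrix.of fun p q => A (p.2, p.1) (q.2, q.1)

/-- The quantum Yang–Baxter equation `R₁₂R₁₃R₂₃ = R₂₃R₁₃R₁₂`. -/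
def QYBE (R : Matrix (I2 n) (I2 n) k) : Prop :=
  amp12 R * amp13 R * amp23 R = amp23 R * amp13 R * amp12 R

/-- `Rtil` is the second inverse `R̃ = ((R^{t₂})⁻¹)^{t₂}` of `R`, characterized by
`R̃ⁱₐᵇₗ Rᵃⱼᵏᵦ = δⁱⱼ δᵏₗ = Rⁱₐᵇₗ R̃ᵃⱼᵏᵦ` (sum over `a`, `b`).  Here the entry
`R ((i,k),(j,l))` denotes `Rⁱⱼᵏₗ`. -/
def IsSecondInverse (R Rtil : Matrix (I2 n) (I2 n) k) : Prop :=
  (∀ i j kk l : Fin n, ∑ a, ∑ b, Rtil (i, b) (a, l) * R (a, kk) (j, b)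
      = (if i = j then (1 : k) else 0) * (if kk = l then 1 else 0)) ∧
  (∀ i j kk l : Fin n, ∑ a, ∑ b, R (i, b) (a, l) * Rtil (a, kk) (j, b)
      = (if i = j then (1 : k) else 0) * (if kk = l then 1 else 0))

/-- The structure constants
`c^{IJ}_K = R̃ᵃ_{i₁}{}^{j₀}_b R⁻¹{}ᵇ_{k₀}{}^{i₀}_c R^{k₁}_n{}ᶜ_m Rᵐₐ{}ⁿ_{j₁}`
of the matrix braided-Lie algebra associated to a bi-invertible R-matrix
(repeated indices summed). -/
def braidedC (R Rinv Rtil : Matrix (I2 n) (I2 n) k) (I J K : I2 n) : k :=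
  ∑ a, ∑ b, ∑ c, ∑ m, ∑ nn,
    Rtil (a, J.1) (I.2, b) * Rinv (b, I.1) (K.1, c) *
      R (K.2, c) (nn, m) * R (m, nn) (a, J.2)

/-- The standard `GL_q(2)` R-matrix `((q,0,0,0),(0,1,q−q⁻¹,0),(0,0,1,0),(0,0,0,q))`,
with rows labelled `(i,k)` and columns `(j,l)` in the order `(1,1),(1,2),(2,1),(2,2)`. -/
def Rgl2 (k : Type*) [Field k] (q : k) : Matrix (I2 2) (I2 2) k :=
  Matrix.of fun p r =>
    if p = r then (if p = ((0 : Fin 2), (0 : Fin 2)) ∨ p = (1, 1) then q else 1)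
    else if p = ((0 : Fin 2), (1 : Fin 2)) ∧ r = (1, 0) then q - q⁻¹ else 0

/-- The `gl_{1|1}` (Alexander–Conway) R-matrix
`((q,0,0,0),(0,1,q−q⁻¹,0),(0,0,1,0),(0,0,0,−q⁻¹))`. -/
def Rgl11 (k : Type*) [Field k] (q : k) : Matrix (I2 2) (I2 2) k :=
  Matrix.of fun p r =>
    if p = r then
      (if p = ((0 : Fin 2), (0 : Fin 2)) then q else if p = (1, 1) then -q⁻¹ else 1)
    else if p = ((0 : Fin 2), (1 : Fin 2)) ∧ r = (1, 0) then q - q⁻¹ else 0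

/-- The braided-Lie bracket extended bilinearly to coefficient vectors with respect to the
basis `u^I`: `Br(x, y)_K = Σ_{I,J} x_I y_J c^{IJ}_K`. -/
def Br {k : Type*} [Field k] (R Rinv Rtil : Matrix (I2 2) (I2 2) k)
    (x y : I2 2 → k) : I2 2 → k :=
  fun K => ∑ I, ∑ J, x I * y J * braidedC R Rinv Rtil I J K

/-- Coefficient vector of the generator `a = u¹₁`. -/
def va (k : Type*) [Field k] : I2 2 → k := fun K => if K = (0, 0) then 1 else 0

/-- Coefficient vector of the generator `b = u¹₂`. -/
def vb (k : Type*) [Field k] : I2 2 → k := fun K => if K = (0, 1) then 1 else 0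

/-- Coefficient vector of the generator `c = u²₁`. -/
def vc (k : Type*) [Field k] : I2 2 → k := fun K => if K = (1, 0) then 1 else 0

/-- Coefficient vector of the generator `d = u²₂`. -/
def vd (k : Type*) [Field k] : I2 2 → k := fun K => if K = (1, 1) then 1 else 0

/-- Upper-triangular six-vertex matrix with parameters `x, y`. -/
def sixV {k : Type*} [Field k] (x y : k) : Matrix (I2 2) (I2 2) k :=
  Matrix.of fun p r =>
    if p = r then (if p = ((0 : Fin 2), (0 : Fin 2)) ∨ p = (1, 1) then x else 1)
    else if p = ((0 : Fin 2), (1 : Fin 2)) ∧ r = (1, 0) then y else 0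

theorem rinv_eq {k : Type*} [Field k] (q : k) (hq0 : q ≠ 0)
    (Rinv : Matrix (I2 2) (I2 2) k) (h2 : Rinv * Rgl2 k q = 1) :
    Rinv = sixV q⁻¹ (-(q - q⁻¹)) := by
  have h : Rgl2 k q * sixV q⁻¹ (-(q - q⁻¹)) = 1 := by
    ext ⟨i, j⟩ ⟨a, b⟩
    fin_cases i <;> fin_cases j <;> fin_cases a <;> fin_cases b <;>
      simp [Matrix.mul_apply, Fintype.sum_prod_type, Rgl2, sixV, hq0, Matrix.one_apply]
  calc Rinv = Rinv * (Rgl2 k q * sixV q⁻¹ (-(q - q⁻¹))) := by rw [h, mul_one]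
    _ = _ := by rw [← mul_assoc, h2, one_mul]

theorem rtil_eq {k : Type*} [Field k] (q : k) (hq0 : q ≠ 0)
    (Rtil : Matrix (I2 2) (I2 2) k) (ht : IsSecondInverse (Rgl2 k q) Rtil) :
    Rtil = sixV q⁻¹ (-(q - q⁻¹) * q⁻¹ ^ 2) := by
  have h := ht.1
  ext ⟨i, b⟩ ⟨a, l⟩
  have e00 := h i 0 0 l
  have e01 := h i 0 1 l
  have e10 := h i 1 0 l
  have e11 := h i 1 1 l
  fin_cases i <;> fin_cases l <;> fin_cases a <;> fin_cases b <;>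
    simp [Fin.sum_univ_two, Rgl2, sixV] at e00 e01 e10 e11 ⊢ <;> grind

/-- For the standard `GL_q(2)` R-matrix, the element `γ = q⁻²a + d` satisfies
`[γ, x] = (q⁶+1)q⁻⁴ x` for `x ∈ {ξ, b, c}`, where `ξ = d − a`. -/
theorem gl2_gamma_brackets (q : k) (hq0 : q ≠ 0) (hq1 : q ^ 2 ≠ 1)
    (Rinv Rtil : Matrix (I2 2) (I2 2) k)
    (h1 : Rgl2 k q * Rinv = 1) (h2 : Rinv * Rgl2 k q = 1)
    (ht : IsSecondInverse (Rgl2 k q) Rtil) :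
    let R := Rgl2 k q
    let ξv : I2 2 → k := vd k - va k
    let γv : I2 2 → k := (q⁻¹) ^ 2 • va k + vd k
    Br R Rinv Rtil γv ξv = ((q ^ 6 + 1) * (q⁻¹) ^ 4) • ξv
    ∧ Br R Rinv Rtil γv (vb k) = ((q ^ 6 + 1) * (q⁻¹) ^ 4) • vb k
    ∧ Br R Rinv Rtil γv (vc k) = ((q ^ 6 + 1) * (q⁻¹) ^ 4) • vc k := by
  have hi := rinv_eq q hq0 Rinv h2
  have hT := rtil_eq q hq0 Rtil ht
  subst hi hT
  intro R ξv γv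
  refine ⟨?_, ?_, ?_⟩ <;> ext ⟨i, j⟩ <;> fin_cases i <;> fin_cases j <;>
    simp [R, ξv, γv, Br, braidedC, Fintype.sum_prod_type, Fin.sum_univ_two, Rgl2, sixV,
      va, vb, vc, vd] <;> field_simp <;> ring
end

section
/- For the gl_{1|1} R-matrix, the braided-Killing form g^{IJ} = c^{IA}_B c^{JL}_A 𝐑̃^K_L{}^B_K restricted to the shifted generators χ (g_χ) is degenerate: g_χ = −(1+q⁻⁴) E₁₁ in the basis (ā, b̄, c̄, ξ̄), i.e., it has rank 1. -/
open Matrix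

variable {k : Type*} [Field k] {n : ℕ}

/-- The induced multi-index braiding matrix
`𝐑^K_L{}^I_J = R^{i₀}_a{}^d_{l₀} R⁻¹{}^a_{j₀}{}^{l₁}_b R^{j₁}_c{}^b_{k₁} R̃^c_{i₁}{}^{k₀}_d`
(repeated indices summed), with rows `(K, I)` and columns `(L, J)`. -/
def bigR (R Rinv Rtil : Matrix (I2 n) (I2 n) k) :
    Matrix (I2 n × I2 n) (I2 n × I2 n) k :=
  Matrix.of fun P Q =>
    ∑ a, ∑ b, ∑ c, ∑ d,
      R (P.2.1, d) (a, Q.1.1) * Rinv (a, Q.1.2) (Q.2.1, b) *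
        R (Q.2.2, b) (c, P.1.2) * Rtil (c, P.1.1) (P.2.2, d)

/-- `Btil` is the second inverse of the multi-index matrix `B`. -/
def IsBigSecondInverse (B Btil : Matrix (I2 n × I2 n) (I2 n × I2 n) k) : Prop :=
  (∀ I J K L : I2 n, ∑ A, ∑ Bb, Btil (I, Bb) (A, L) * B (A, K) (J, Bb)
      = (if I = J then (1 : k) else 0) * (if K = L then 1 else 0)) ∧
  (∀ I J K L : I2 n, ∑ A, ∑ Bb, B (I, Bb) (A, L) * Btil (A, K) (J, Bb)
      = (if I = J then (1 : k) else 0) * (if K = L then 1 else 0))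

/-- The braided dimension `dim(𝓛) = 𝐑̃^K_J{}^J_K` (sum over `J`, `K`). -/
def braidedDim (Btil : Matrix (I2 n × I2 n) (I2 n × I2 n) k) : k :=
  ∑ J, ∑ K, Btil (K, J) (J, K)

/-- The braided Killing form `g^{IJ} = c^{IA}_B c^{JL}_A 𝐑̃^K_L{}^B_K`. -/
def killingG (R Rinv Rtil : Matrix (I2 n) (I2 n) k)
    (Btil : Matrix (I2 n × I2 n) (I2 n × I2 n) k) (I J : I2 n) : k :=
  ∑ A, ∑ B, ∑ L, ∑ K,
    braidedC R Rinv Rtil I A B * braidedC R Rinv Rtil J L A * Btil (K, B) (L, K)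

/-- The braided trace `T^I = c^{IJ}_A 𝐑̃^K_J{}^A_K`. -/
def braidedT (R Rinv Rtil : Matrix (I2 n) (I2 n) k)
    (Btil : Matrix (I2 n × I2 n) (I2 n × I2 n) k) (I : I2 n) : k :=
  ∑ J, ∑ A, ∑ K, braidedC R Rinv Rtil I J A * Btil (K, A) (J, K)

/-- `δ^I = δ^{i₀}_{i₁}`. -/
def deltaI (k : Type*) [Field k] {n : ℕ} (I : I2 n) : k := if I.1 = I.2 then 1 else 0

lemma swap4 {X : Type*} [Fintype X] (f : X → X → X → X → k) :
    ∑ a, ∑ b, ∑ c, ∑ d, f a b c d = ∑ c, ∑ d, ∑ a, ∑ b, f a b c d := by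
  have := Finset.sum_comm (s := Finset.univ) (t := Finset.univ)
    (f := fun (p : X × X) (r : X × X) => f p.1 p.2 r.1 r.2)
  simpa only [Fintype.sum_prod_type] using this

/-- Explicit second inverse. -/
def Tx (q : k) : Matrix (I2 2) (I2 2) k :=
  Matrix.of fun p r =>
    if p = r then
      (if p = ((0 : Fin 2), (0 : Fin 2)) then q⁻¹ else if p = (1, 1) then -q else 1)
    else if p = ((0 : Fin 2), (1 : Fin 2)) ∧ r = (1, 0) then q - q⁻¹ else 0

lemma Rinv_eq (q : k) (hq0 : q ≠ 0) (Rinv : Matrix (I2 2) (I2 2) k)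
    (h2 : Rinv * Rgl11 k q = 1) : Rinv = Rgl11 k q⁻¹ := by
  have h : Rgl11 k q * Rgl11 k q⁻¹ = 1 := by
    ext ⟨a, b⟩ ⟨c, d⟩
    fin_cases a <;> fin_cases b <;> fin_cases c <;> fin_cases d <;>
      simp [Rgl11, Matrix.mul_apply, Fintype.sum_prod_type, Fin.sum_univ_two, hq0]
  calc Rinv = Rinv * (Rgl11 k q * Rgl11 k q⁻¹) := by rw [h, mul_one]
    _ = Rgl11 k q⁻¹ := by rw [← mul_assoc, h2, one_mul]

set_option maxHeartbeats 4000000 in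
lemma Rtil_eq (q : k) (hq0 : q ≠ 0) (Rtil : Matrix (I2 2) (I2 2) k)
    (ht : IsSecondInverse (Rgl11 k q) Rtil) : Rtil = Tx q := by
  have H := ht.2
  have e1 : ∀ kk j : Fin 2, Rtil (1, kk) (j, 1)
      = -q * ((if (1 : Fin 2) = j then (1 : k) else 0) * (if kk = 1 then 1 else 0)) := by
    intro kk j
    have := H 1 j kk 1
    rw [← this]
    simp [Rgl11, Fin.sum_univ_two]
    field_simp
  ext ⟨a, b⟩ ⟨c, d⟩
  have h := H a c b d
  have h' := e1 b c
  fin_cases a <;> fin_cases b <;> fin_cases c <;> fin_cases d <;>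
    simp [Rgl11, Tx, Fin.sum_univ_two] at h h' ⊢ <;> simp [h, h'] at h ⊢ <;>
    first
      | done
      | exact h
      | exact h.resolve_left hq0
      | exact eq_inv_of_mul_eq_one_right h
      | (apply mul_left_cancel₀ hq0; linear_combination h)

/-- Explicit partial trace of the second inverse of the big braiding. -/
def Dx (q : k) (L B : I2 2) : k :=
  if L = (0, 0) then (if B = (0, 0) then q ^ 2 else if B = (1, 1) then q ^ 2 - 1 else 0)
  else if L = (1, 1) then
    (if B = (0, 0) then 1 - q ^ 2 else if B = (1, 1) then 2 - q ^ 2 else 0)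
  else if L = B then -1 else 0

set_option maxHeartbeats 4000000 in
lemma D0 (q : k) (hq0 : q ≠ 0) (K J : I2 2) :
    ∑ A, ∑ B, Dx q A B * bigR (Rgl11 k q) (Rgl11 k q⁻¹) (Tx q) (A, K) (J, B)
      = if J = K then 1 else 0 := by
  obtain ⟨a, b⟩ := K
  obtain ⟨c, d⟩ := J
  fin_cases a <;> fin_cases b <;> fin_cases c <;> fin_cases d <;>
    simp [Dx, Fintype.sum_prod_type, Fin.sum_univ_two] <;>
    simp [bigR, Rgl11, Tx, Fin.sum_univ_two] <;>
    field_simp <;> ring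

lemma D_eq (B Btil : Matrix (I2 2 × I2 2) (I2 2 × I2 2) k)
    (hB : IsBigSecondInverse B Btil) (D : I2 2 → I2 2 → k)
    (hD : ∀ K J, ∑ A, ∑ Bb, D A Bb * B (A, K) (J, Bb) = if J = K then 1 else 0)
    (L M : I2 2) : ∑ K, Btil (K, M) (L, K) = D L M := by
  have h : ∑ J, ∑ K, (∑ A, ∑ Bb, D A Bb * B (A, K) (J, Bb)) * Btil (J, M) (L, K)
      = D L M := by
    calc _ = ∑ A, ∑ Bb, D A Bb * ∑ J, ∑ K, B (A, K) (J, Bb) * Btil (J, M) (L, K) := by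
          simp only [Finset.sum_mul, Finset.mul_sum, mul_assoc]
          exact swap4 _
      _ = _ := by
          simp only [hB.2]
          simp
  rw [← h]
  simp [hD]

/-- Explicit structure constants. -/
def Cx (q : k) (I J K : I2 2) : k :=
  if I = (0, 0) then
    (if J = K then (if J = (0, 1) then (q⁻¹) ^ 2 else if J = (1, 0) then q ^ 2 else 1) else 0)
  else if I = (0, 1) then
    (if J = (1, 0) then (if K = (0, 0) then q ^ 2 - 1 else if K = (1, 1) then 1 - q ^ 2 else 0)
     else if J ≠ (0, 1) ∧ K = (0, 1) then 1 - (q⁻¹) ^ 2 else 0)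
  else if I = (1, 0) then
    (if J = (0, 1) then
      (if K = (0, 0) then 1 - (q⁻¹) ^ 2 else if K = (1, 1) then (q⁻¹) ^ 2 - 1 else 0)
     else if J ≠ (1, 0) ∧ K = (1, 0) then 1 - q ^ 2 else 0)
  else
    (if J = (0, 1) then (if K = (0, 1) then (q⁻¹) ^ 2 else 0)
     else if J = (1, 0) then (if K = (1, 0) then q ^ 2 else 0)
     else (if K = (0, 0) then (q - q⁻¹) ^ 2 + (if J = K then 1 else 0)
       else if K = (1, 1) then -(q - q⁻¹) ^ 2 + (if J = K then 1 else 0) else 0))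

set_option maxHeartbeats 4000000 in
lemma C_eq (q : k) (hq0 : q ≠ 0) (I J K : I2 2) :
    braidedC (Rgl11 k q) (Rgl11 k q⁻¹) (Tx q) I J K = Cx q I J K := by
  obtain ⟨a, b⟩ := I
  obtain ⟨c, d⟩ := J
  obtain ⟨e, f⟩ := K
  fin_cases a <;> fin_cases b <;> fin_cases c <;> fin_cases d <;>
    fin_cases e <;> fin_cases f <;>
    simp [braidedC, Cx, Rgl11, Tx, Fin.sum_univ_two, hq0] <;>
    field_simp <;> ring

set_option maxHeartbeats 4000000 in
lemma G_eq (q : k) (hq0 : q ≠ 0) (I J : I2 2) :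
    ∑ A, ∑ B, ∑ L, Cx q I A B * Cx q J L A * Dx q L B
     = if I.1 = I.2 ∧ J.1 = J.2 then
       -(1 + (q⁻¹) ^ 4) * (q ^ 2 - 1) ^ 2 - 2 * (q - q⁻¹) ^ 2 else 0 := by
  obtain ⟨a, b⟩ := I
  obtain ⟨c, d⟩ := J
  fin_cases a <;> fin_cases b <;> fin_cases c <;> fin_cases d <;>
    simp [Cx, Dx, Fintype.sum_prod_type, Fin.sum_univ_two] <;>
    field_simp <;> ring

set_option maxHeartbeats 4000000 in
lemma T_eq (q : k) (hq0 : q ≠ 0) (I : I2 2) :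
    ∑ J, ∑ A, Cx q I J A * Dx q J A
     = if I.1 = I.2 then -(q - q⁻¹) ^ 2 else 0 := by
  obtain ⟨a, b⟩ := I
  fin_cases a <;> fin_cases b <;>
    simp [Cx, Dx, Fintype.sum_prod_type, Fin.sum_univ_two] <;>
    field_simp <;> ring

/-- For the `gl_{1|1}` R-matrix, the braided-Killing form restricted to the shifted rescaled
generators `χ̄^I = (q²−1)⁻¹(u^I − δ^I)` is degenerate: in the basis `(ā, b̄, c̄, ξ̄)` it is
the rank-one matrix `−(1+q⁻⁴) E₁₁`; in particular its determinant vanishes. -/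
theorem gl11_killing_degenerate (q : k) (hq0 : q ≠ 0) (hq1 : q ^ 2 ≠ 1)
    (Rinv Rtil : Matrix (I2 2) (I2 2) k)
    (h1 : Rgl11 k q * Rinv = 1) (h2 : Rinv * Rgl11 k q = 1)
    (ht : IsSecondInverse (Rgl11 k q) Rtil)
    (Btil : Matrix (I2 2 × I2 2) (I2 2 × I2 2) k)
    (hB : IsBigSecondInverse (bigR (Rgl11 k q) Rinv Rtil) Btil) :
    let R := Rgl11 k q
    -- the Killing form on the shifted rescaled generators `χ̄`
    let gchi : I2 2 → I2 2 → k := fun I J =>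
      ((q ^ 2 - 1)⁻¹) ^ 2 *
        (killingG R Rinv Rtil Btil I J - deltaI k I * braidedT R Rinv Rtil Btil J
          - deltaI k J * braidedT R Rinv Rtil Btil I
          + braidedDim Btil * deltaI k I * deltaI k J)
    -- bilinear extension to coefficient vectors
    let GB : (I2 2 → k) → (I2 2 → k) → k := fun x y => ∑ I, ∑ J, x I * y J * gchi I J
    let e : Fin 4 → (I2 2 → k) := ![va k, vb k, vc k, vd k - va k]
    (∀ i j : Fin 4, GB (e i) (e j)
        = if i = 0 ∧ j = 0 then -(1 + (q⁻¹) ^ 4) else 0)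
    ∧ (Matrix.of fun i j => GB (e i) (e j)).det = 0 := by
  have hi := Rinv_eq q hq0 Rinv h2
  have hr := Rtil_eq q hq0 Rtil ht
  subst hi hr
  have hD := D_eq _ Btil hB (Dx q) (D0 q hq0)
  have hG : ∀ I J, killingG (Rgl11 k q) (Rgl11 k q⁻¹) (Tx q) Btil I J
      = if I.1 = I.2 ∧ J.1 = J.2 then
        -(1 + (q⁻¹) ^ 4) * (q ^ 2 - 1) ^ 2 - 2 * (q - q⁻¹) ^ 2 else 0 := by
    intro I J
    rw [← G_eq q hq0 I J]
    simp only [killingG, ← Finset.mul_sum, hD, C_eq q hq0]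
  have hT : ∀ I, braidedT (Rgl11 k q) (Rgl11 k q⁻¹) (Tx q) Btil I
      = if I.1 = I.2 then -(q - q⁻¹) ^ 2 else 0 := by
    intro I
    rw [← T_eq q hq0 I]
    simp only [braidedT, ← Finset.mul_sum, hD, C_eq q hq0]
  have hdim : braidedDim Btil = 0 := by
    simp only [braidedDim, hD]
    simp [Dx, Fintype.sum_prod_type, Fin.sum_univ_two]
    ring
  have hq : q ^ 2 - 1 ≠ 0 := sub_ne_zero.mpr hq1
  intro R gchi GB e
  have hg : ∀ I J, gchi I J = if I.1 = I.2 ∧ J.1 = J.2 then -(1 + (q⁻¹) ^ 4) else 0 := by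
    intro I J
    simp only [gchi, R, hG, hT, hdim, deltaI]
    by_cases hI : I.1 = I.2 <;> by_cases hJ : J.1 = J.2 <;> simp [hI, hJ]
    field_simp
    ring
  have main : ∀ i j : Fin 4, GB (e i) (e j)
        = if i = 0 ∧ j = 0 then -(1 + (q⁻¹) ^ 4) else 0 := by
    intro i j
    simp only [GB, hg]
    fin_cases i <;> fin_cases j <;>
      simp [e, va, vb, vc, vd, Fintype.sum_prod_type, Fin.sum_univ_two]
  refine ⟨main, ?_⟩
  apply Matrix.det_eq_zero_of_row_eq_zero 1
  intro j
  simp [main]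
end
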